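/- Let α ∈ [1/3,1/2]. Then the function θ_α is monotone increasing on (0,∞), θ_α(t) → α as t → 0+, and θ_α(t) → 1/2 as t → +∞. -/

import Mathlib

open MeasureTheory Complex Set Filter

/-- The function `G_α` from Fourati's paper: for `z` in the slit plane,
`G_α(z) = (2πi)⁻¹ ∫_0^∞ (exp(-e^{-iπα} y^α z^{1-α}) - exp(-e^{iπα} y^α z^{1-α})) z⁻¹ e^{-y} dy`,
all complex powers being principal branches. -/
noncomputable def Galpha (α : ℝ) (z : ℂ) : ℂ :=
  (2 * Real.pi * Complex.I)⁻¹ *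
    ∫ y in Set.Ioi (0:ℝ),
      ((Complex.exp (-(Complex.exp (-(Real.pi * α : ℂ) * Complex.I)) * (y:ℂ) ^ (α:ℂ) * z ^ (1 - (α:ℂ))) -
        Complex.exp (-(Complex.exp ((Real.pi * α : ℂ) * Complex.I)) * (y:ℂ) ^ (α:ℂ) * z ^ (1 - (α:ℂ)))) / z) *
      Complex.exp (-(y:ℂ))

/-- The upper boundary value `G_α(-r^+)`. -/
noncomputable def GalphaPlus (α r : ℝ) : ℂ :=
  (2 * Real.pi * Complex.I)⁻¹ *
    ∫ y in Set.Ioi (0:ℝ),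
      ((Complex.exp ((r:ℂ) ^ (1 - (α:ℂ)) * (y:ℂ) ^ (α:ℂ)) -
        Complex.exp (Complex.exp (-(2 * Real.pi * α : ℂ) * Complex.I) * (r:ℂ) ^ (1 - (α:ℂ)) * (y:ℂ) ^ (α:ℂ))) / (r:ℂ)) *
      Complex.exp (-(y:ℂ))

/-- `θ_α(r) = -arg(G_α(-r^+))/π`. -/
noncomputable def thetaFun (α r : ℝ) : ℝ := -(GalphaPlus α r).arg / Real.pi

/-- Zolotarev's integral formula for the density of the strictly `α`-stable
distribution with positivity parameter `ρ` (the integral is a real number; we take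
the real part). -/
noncomputable def stableDensity (α ρ x : ℝ) : ℝ :=
  ((2 * Real.pi * Complex.I)⁻¹ *
    ∫ y in Set.Ioi (0:ℝ),
      ((Complex.exp (-(Complex.exp (-(Real.pi * ρ * α : ℂ) * Complex.I)) * (y:ℂ) ^ (α:ℂ) * (x:ℂ) ^ (-(α:ℂ))) -
        Complex.exp (-(Complex.exp ((Real.pi * ρ * α : ℂ) * Complex.I)) * (y:ℂ) ^ (α:ℂ) * (x:ℂ) ^ (-(α:ℂ)))) / (x:ℂ)) *
      Complex.exp (-(y:ℂ))).re

/-- A function is completely monotone (on `(0,∞)`) if it is infinitely differentiable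
there and `(-1)^n f^{(n)}(x) ≥ 0` for all `n` and `x > 0`. -/
def CompletelyMonotone (φ : ℝ → ℝ) : Prop :=
  ContDiffOn ℝ (⊤ : ℕ∞) φ (Set.Ioi 0) ∧
  ∀ (n : ℕ) (x : ℝ), 0 < x → 0 ≤ (-1 : ℝ) ^ n * iteratedDeriv n φ x

/-- A function `H` on `(0,∞)` is hyperbolically completely monotone if for every `u > 0`
the function `v ↦ H(uv)H(u/v)` is a completely monotone function of `v + 1/v`. -/
def HCM (H : ℝ → ℝ) : Prop :=
  ∀ u : ℝ, 0 < u → ∃ φ : ℝ → ℝ, CompletelyMonotone φ ∧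
    ∀ v : ℝ, 0 < v → H (u * v) * H (u / v) = φ (v + 1 / v)

lemma integrableOn_rpow_mul_exp_sub_rpow {p a k : ℝ} (hp : 2 ≤ p) (ha : 0 < a) (hk : -1 < k)
    (S : ℝ) : IntegrableOn (fun u : ℝ => u ^ k * Real.exp (S * u - a * u ^ p)) (Ioi 0) := by
  have hg := (integrableOn_rpow_mul_exp_neg_mul_sq (b := a / 2) (by positivity) hk).const_mul
    (Real.exp (a + S ^ 2 / (2 * a)))
  refine Integrable.mono' hg ?_ ?_
  · exact Measurable.aestronglyMeasurable (by fun_prop)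
  · refine (ae_restrict_iff' measurableSet_Ioi).2 (ae_of_all _ fun u hu => ?_)
    have hu : 0 < u := hu
    have h1 : u ^ 2 - 1 ≤ u ^ p := by
      rcases le_total 1 u with h | h
      · have := Real.rpow_le_rpow_of_exponent_le h hp
        rw [Real.rpow_two] at this
        linarith
      · have := Real.rpow_nonneg hu.le p
        nlinarith
    have h2 : S * u ≤ a / 2 * u ^ 2 + S ^ 2 / (2 * a) := by
      have : 0 ≤ (a * u - S) ^ 2 / (2 * a) := by positivity
      have e : (a * u - S) ^ 2 / (2 * a) = a / 2 * u ^ 2 + S ^ 2 / (2 * a) - S * u := by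
        field_simp
        ring
      linarith
    rw [Real.norm_of_nonneg (by positivity), mul_left_comm, ← Real.exp_add]
    gcongr
    nlinarith [mul_le_mul_of_nonneg_left h1 ha.le]

/-- The integral `∫₀^∞ (exp (s u) - c exp (c s u)) exp (-u ^ p) du`. -/
noncomputable def rayDiff (p : ℝ) (c : ℂ) (s : ℝ) : ℂ :=
  ∫ u in Ioi (0 : ℝ), (Complex.exp (s * u) - c * Complex.exp (c * s * u)) *
    (Real.exp (-u ^ p) : ℂ)

lemma norm_exp_mul_le {c : ℂ} (hc : ‖c‖ ≤ 1) {x : ℝ} (hx : 0 ≤ x) :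
    ‖Complex.exp (c * x)‖ ≤ Real.exp x := by
  rw [Complex.norm_exp]
  gcongr
  have := (Complex.re_le_norm c).trans hc
  simp
  nlinarith

lemma norm_exp_mul_mul_le {c : ℂ} (hc : ‖c‖ ≤ 1) {x u : ℝ} (hu : 0 ≤ u) :
    ‖Complex.exp (c * x * u)‖ ≤ Real.exp (|x| * u) := by
  have h : c * x * u = c * (SignType.sign x : ℝ) * ((|x| * u : ℝ) : ℂ) := by
    rw [mul_assoc, mul_assoc]
    congr 1
    norm_cast
    rw [← mul_assoc, sign_mul_abs]
  rw [h]
  refine norm_exp_mul_le ?_ (by positivity)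
  rw [norm_mul]
  refine mul_le_one₀ hc (norm_nonneg _) ?_
  rcases lt_trichotomy x 0 with h | h | h <;> simp [h]

lemma norm_exp_sub_mul_exp_le {c d : ℂ} (hc : ‖c‖ ≤ 1) (hd : ‖d‖ ≤ 1) (p : ℝ) {x M u : ℝ}
    (hx : |x| ≤ M) (hu : 0 < u) :
    ‖(Complex.exp (x * u) - d * Complex.exp (c * x * u)) * (Real.exp (-u ^ p) : ℂ)‖ ≤
      2 * Real.exp (M * u - 1 * u ^ p) := by
  have h1 : ‖Complex.exp (x * u)‖ ≤ Real.exp (M * u) := by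
    have := norm_exp_mul_mul_le (c := 1) (by simp) (x := x) hu.le
    rw [one_mul] at this
    exact this.trans (by gcongr)
  have h2 : ‖d * Complex.exp (c * x * u)‖ ≤ Real.exp (M * u) := by
    rw [norm_mul]
    refine (mul_le_of_le_one_left (norm_nonneg _) hd).trans ?_
    exact (norm_exp_mul_mul_le hc hu.le).trans (by gcongr)
  rw [norm_mul, sub_eq_add_neg (M * u), Real.exp_add, ← mul_assoc, one_mul,
    Complex.norm_real, Real.norm_of_nonneg (Real.exp_pos _).le]
  gcongr
  exact (norm_sub_le _ _).trans (by linarith)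

lemma hasDerivAt_rayDiff {p : ℝ} (hp : 2 ≤ p) {c : ℂ} (hc : ‖c‖ ≤ 1) (s : ℝ) :
    IntegrableOn (fun u : ℝ => (u : ℂ) * (Complex.exp (s * u) - c ^ 2 * Complex.exp (c * s * u)) *
      (Real.exp (-u ^ p) : ℂ)) (Ioi 0) ∧
    HasDerivAt (rayDiff p c) (∫ u in Ioi (0 : ℝ), (u : ℂ) *
      (Complex.exp (s * u) - c ^ 2 * Complex.exp (c * s * u)) * (Real.exp (-u ^ p) : ℂ)) s := by
  have hb (k : ℝ) (hk : -1 < k) :=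
    (integrableOn_rpow_mul_exp_sub_rpow hp one_pos hk (|s| + 1)).const_mul 2
  have key : ∀ x ∈ Metric.ball s 1, |x| ≤ |s| + 1 := by
    intro x hx
    rw [Metric.mem_ball, Real.dist_eq] at hx
    have := abs_sub_abs_le_abs_sub x s
    linarith
  refine hasDerivAt_integral_of_dominated_loc_of_deriv_le (Metric.ball_mem_nhds s one_pos)
    (F' := fun x u => (u : ℂ) *
      (Complex.exp (x * u) - c ^ 2 * Complex.exp (c * x * u)) * (Real.exp (-u ^ p) : ℂ))
    (bound := fun u => 2 * (u ^ (1 : ℝ) * Real.exp ((|s| + 1) * u - 1 * u ^ p))) ?_ ?_ ?_ ?_ ?_ ?_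
  · exact Eventually.of_forall fun x => Measurable.aestronglyMeasurable (by fun_prop)
  · refine Integrable.mono' (hb 0 (by norm_num)) (Measurable.aestronglyMeasurable (by fun_prop)) ?_
    refine (ae_restrict_iff' measurableSet_Ioi).2 (ae_of_all _ fun u hu => ?_)
    simpa using norm_exp_sub_mul_exp_le hc hc p (key s (Metric.mem_ball_self one_pos)) hu
  · exact Measurable.aestronglyMeasurable (by fun_prop)
  · refine (ae_restrict_iff' measurableSet_Ioi).2 (ae_of_all _ fun u hu x hx => ?_)
    have hu : 0 < u := hu
    have := norm_exp_sub_mul_exp_le hc (d := c ^ 2)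
      (by rw [norm_pow]; exact pow_le_one₀ (norm_nonneg c) hc) p (key x hx) hu
    rw [mul_assoc, norm_mul, Complex.norm_real, Real.norm_of_nonneg hu.le, Real.rpow_one,
      mul_left_comm]
    gcongr
  · exact hb 1 (by norm_num)
  · refine ae_of_all _ fun u x _ => ?_
    have h1 : HasDerivAt (fun x : ℝ => Complex.exp (x * u)) (Complex.exp (x * u) * u) x := by
      simpa using (((hasDerivAt_id (x : ℂ)).mul_const (u : ℂ)).cexp).comp_ofReal
    have h2 : HasDerivAt (fun x : ℝ => Complex.exp (c * x * u))
        (Complex.exp (c * x * u) * (c * u)) x := by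
      simpa using ((((hasDerivAt_id (x : ℂ)).const_mul c).mul_const (u : ℂ)).cexp).comp_ofReal
    refine ((h1.sub (h2.const_mul c)).mul_const (Real.exp (-u ^ p) : ℂ)).congr_deriv ?_
    ring

lemma integral_exp_rpow_eq_rayDiff {p : ℝ} (hp : 2 ≤ p) {c : ℂ} (hc : ‖c‖ ≤ 1) {s : ℝ}
    (hs : 0 ≤ s) :
    ∫ y in Ioi (0 : ℝ), (Complex.exp (s * (y ^ p⁻¹ : ℝ)) - Complex.exp (c * s * (y ^ p⁻¹ : ℝ))) *
      (Real.exp (-y) : ℂ) = s * rayDiff p c s := by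
  have hp0 : 0 < p := by linarith
  rw [← integral_comp_rpow_Ioi_of_pos hp0]
  have hcongr : ∫ u in Ioi (0 : ℝ), (p * u ^ (p - 1)) •
      ((Complex.exp (s * ((u ^ p) ^ p⁻¹ : ℝ)) - Complex.exp (c * s * ((u ^ p) ^ p⁻¹ : ℝ))) *
        (Real.exp (-u ^ p) : ℂ)) = ∫ u in Ioi (0 : ℝ), ((p * u ^ (p - 1) : ℝ) : ℂ) *
      ((Complex.exp (s * u) - Complex.exp (c * s * u)) * (Real.exp (-u ^ p) : ℂ)) := by
    refine setIntegral_congr_fun measurableSet_Ioi fun u hu => ?_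
    have hu : 0 < u := hu
    simp only [Real.rpow_rpow_inv hu.le hp0.ne', Complex.real_smul]
  rw [hcongr]
  have hb (k : ℝ) (hk : -1 < k) := (integrableOn_rpow_mul_exp_sub_rpow hp one_pos hk s).const_mul 2
  have int1 : ∀ d : ℂ, ‖d‖ ≤ 1 → IntegrableOn (fun u : ℝ =>
      (Complex.exp (s * u) - d * Complex.exp (c * s * u)) * (Real.exp (-u ^ p) : ℂ)) (Ioi 0) := by
    intro d hd
    refine Integrable.mono' (hb 0 (by norm_num)) (Measurable.aestronglyMeasurable (by fun_prop)) ?_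
    refine (ae_restrict_iff' measurableSet_Ioi).2 (ae_of_all _ fun u hu => ?_)
    simpa using norm_exp_sub_mul_exp_le hc hd p (abs_of_nonneg hs).le hu
  have int2 : IntegrableOn (fun u : ℝ => ((p * u ^ (p - 1) : ℝ) : ℂ) *
      ((Complex.exp (s * u) - Complex.exp (c * s * u)) * (Real.exp (-u ^ p) : ℂ))) (Ioi 0) := by
    refine Integrable.mono' ((hb (p - 1) (by linarith)).const_mul p)
      (Measurable.aestronglyMeasurable (by fun_prop)) ?_
    refine (ae_restrict_iff' measurableSet_Ioi).2 (ae_of_all _ fun u hu => ?_)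
    have hu : 0 < u := hu
    have := norm_exp_sub_mul_exp_le hc (d := 1) (by simp) p (abs_of_nonneg hs).le hu
    rw [one_mul] at this
    rw [norm_mul, Complex.norm_real, Real.norm_of_nonneg (by positivity), mul_assoc,
      mul_left_comm 2]
    gcongr
  have hder : ∀ u ∈ Ici (0 : ℝ), HasDerivAt
      (fun u : ℝ => (Complex.exp (s * u) - Complex.exp (c * s * u)) * (Real.exp (-u ^ p) : ℂ))
      (s * ((Complex.exp (s * u) - c * Complex.exp (c * s * u)) * (Real.exp (-u ^ p) : ℂ)) -
        ((p * u ^ (p - 1) : ℝ) : ℂ) *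
      ((Complex.exp (s * u) - Complex.exp (c * s * u)) * (Real.exp (-u ^ p) : ℂ))) u := by
    intro u _
    have h1 : HasDerivAt (fun u : ℝ => Complex.exp (s * u)) (Complex.exp (s * u) * s) u := by
      simpa using (((hasDerivAt_id (u : ℂ)).const_mul (s : ℂ)).cexp).comp_ofReal
    have h2 : HasDerivAt (fun u : ℝ => Complex.exp (c * s * u))
        (Complex.exp (c * s * u) * (c * s)) u := by
      simpa using (((hasDerivAt_id (u : ℂ)).const_mul (c * s)).cexp).comp_ofReal
    have h3 := ((Real.hasDerivAt_rpow_const (x := u) (p := p)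
      (Or.inr (by linarith))).fun_neg.exp).ofReal_comp
    refine ((h1.sub h2).mul h3).congr_deriv ?_
    simp only [Pi.sub_apply]
    push_cast
    ring
  have hI := ((int1 c hc).const_mul (s : ℂ)).sub int2
  have hlim := tendsto_zero_of_hasDerivAt_of_integrableOn_Ioi
    (fun u hu => hder u (mem_Ici_of_Ioi hu)) hI (by simpa using int1 1 (by simp))
  have h0 := integral_Ioi_of_hasDerivAt_of_tendsto' hder hI hlim
  rw [integral_sub ((int1 c hc).const_mul (s : ℂ)) int2, integral_const_mul] at h0
  simp only [ofReal_zero, mul_zero, sub_self, zero_mul] at h0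
  rw [rayDiff, ← sub_eq_zero.1 h0]

/-- In the logarithmic coordinate `ζ = exp ω`, the primitive vanishing at `ζ = 0` of
`ζ * exp (s * ζ - ζ ^ p)`. -/
noncomputable def logPrimitive (p s : ℝ) (ω : ℂ) : ℂ :=
  ∫ τ in (0 : ℝ)..1, τ * Complex.exp (2 * ω) *
    Complex.exp (s * τ * Complex.exp ω - (τ ^ p : ℝ) * Complex.exp (p * ω))

lemma hasDerivAt_logPrimitive {p : ℝ} (hp : 1 ≤ p) (s : ℝ) (ω : ℂ) :
    HasDerivAt (logPrimitive p s)
      (Complex.exp (2 * ω) * Complex.exp (s * Complex.exp ω - Complex.exp (p * ω))) ω := by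
  have hp0 : 0 < p := by linarith
  have hc : Continuous fun τ : ℝ => τ ^ p := Real.continuous_rpow_const hp0.le
  let F : ℂ → ℝ → ℂ := fun ω τ => τ * Complex.exp (2 * ω) *
    Complex.exp (s * τ * Complex.exp ω - (τ ^ p : ℝ) * Complex.exp (p * ω))
  let F' : ℂ → ℝ → ℂ := fun ω τ => F ω τ *
    (2 + s * τ * Complex.exp ω - p * (τ ^ p : ℝ) * Complex.exp (p * ω))
  have hF : Continuous fun q : ℂ × ℝ => F q.1 q.2 := by
    have : Continuous fun q : ℂ × ℝ => q.2 ^ p := hc.comp continuous_snd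
    fun_prop
  have hF' : Continuous fun q : ℂ × ℝ => F' q.1 q.2 := by
    have : Continuous fun q : ℂ × ℝ => q.2 ^ p := hc.comp continuous_snd
    fun_prop
  obtain ⟨C, hC⟩ := ((isCompact_closedBall ω 1).prod (isCompact_Icc (a := (0 : ℝ)) (b := 1)))
    |>.exists_bound_of_continuousOn hF'.continuousOn
  have hd := (intervalIntegral.hasDerivAt_integral_of_dominated_loc_of_deriv_le (μ := volume)
    (F := F) (F' := F') (a := 0) (b := 1) (bound := fun _ => C) (Metric.ball_mem_nhds ω one_pos)
    (Eventually.of_forall fun x => (hF.comp (by fun_prop : Continuous fun τ : ℝ => (x, τ)))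
      |>.aestronglyMeasurable)
    ((hF.comp (by fun_prop : Continuous fun τ : ℝ => (ω, τ))).intervalIntegrable _ _)
    (hF'.comp (by fun_prop : Continuous fun τ : ℝ => (ω, τ))).aestronglyMeasurable
    (ae_of_all _ fun τ hτ x hx => hC (x, τ) ⟨Metric.ball_subset_closedBall hx, by
      rw [uIoc_of_le zero_le_one] at hτ
      exact Ioc_subset_Icc_self hτ⟩)
    intervalIntegrable_const
    (ae_of_all _ fun τ _ x _ => ?_)).2
  · refine hd.congr_deriv ?_
    have hFTC : ∀ τ ∈ uIcc (0 : ℝ) 1, HasDerivAt (fun τ : ℝ => (τ : ℂ) * F ω τ) (F' ω τ) τ := by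
      intro τ hτ
      rw [uIcc_of_le zero_le_one] at hτ
      have h1 : HasDerivAt (fun τ : ℝ => (τ : ℂ)) 1 τ := Complex.ofRealCLM.hasDerivAt
      have h2 := (Real.hasDerivAt_rpow_const (x := τ) (p := p) (Or.inr hp)).ofReal_comp
      have h3 := (((h1.const_mul (s : ℂ)).mul_const (Complex.exp ω)).sub
        (h2.mul_const (Complex.exp (p * ω)))).cexp
      refine (h1.mul ((h1.mul_const (Complex.exp (2 * ω))).mul h3)).congr_deriv ?_
      have h4 : ((τ ^ p : ℝ) : ℂ) = τ * (τ ^ (p - 1) : ℝ) := by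
        rw [← Complex.ofReal_mul, mul_comm, ← Real.rpow_add_one' hτ.1 (by linarith)]
        simp
      simp only [F', F, Pi.sub_apply, Pi.mul_apply, h4]
      push_cast
      ring
    rw [intervalIntegral.integral_eq_sub_of_hasDerivAt hFTC
      ((hF'.comp (by fun_prop : Continuous fun τ : ℝ => (ω, τ))).intervalIntegrable _ _)]
    simp [F]
  · have h1 : HasDerivAt (fun x : ℂ => Complex.exp (2 * x)) (Complex.exp (2 * x) * 2) x := by
      simpa using ((hasDerivAt_id x).const_mul 2).cexp
    have h2 : HasDerivAt (fun x : ℂ => Complex.exp (p * x)) (Complex.exp (p * x) * p) x := by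
      simpa using ((hasDerivAt_id x).const_mul (p : ℂ)).cexp
    refine ((h1.const_mul (τ : ℂ)).mul (((Complex.hasDerivAt_exp x).const_mul (s * τ : ℂ)).sub
      (h2.const_mul ((τ ^ p : ℝ) : ℂ))).cexp).congr_deriv ?_
    simp only [F', F, Pi.sub_apply]
    ring

lemma norm_logPrimitive_le {p s : ℝ} (hp : 0 ≤ p) (hs : 0 ≤ s) (ω : ℂ) :
    ‖logPrimitive p s ω‖ ≤
      Real.exp (2 * ω.re) * Real.exp (s * Real.exp ω.re + Real.exp (p * ω.re)) := by
  have := intervalIntegral.norm_integral_le_of_norm_le_const (a := 0) (b := 1)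
    (f := fun τ : ℝ => τ * Complex.exp (2 * ω) *
      Complex.exp (s * τ * Complex.exp ω - (τ ^ p : ℝ) * Complex.exp (p * ω)))
    (C := Real.exp (2 * ω.re) * Real.exp (s * Real.exp ω.re + Real.exp (p * ω.re))) ?_
  · simpa [logPrimitive] using this
  intro τ hτ
  rw [uIoc_of_le zero_le_one] at hτ
  have h1 : τ ^ p ≤ 1 := Real.rpow_le_one hτ.1.le hτ.2 hp
  have h0 : 0 ≤ τ ^ p := Real.rpow_nonneg hτ.1.le p
  have e1 : ‖Complex.exp ω‖ = Real.exp ω.re := Complex.norm_exp ω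
  have e2 : ‖Complex.exp (p * ω)‖ = Real.exp (p * ω.re) := by simp [Complex.norm_exp]
  have e3 : ‖Complex.exp (2 * ω)‖ = Real.exp (2 * ω.re) := by simp [Complex.norm_exp]
  rw [norm_mul, norm_mul, e3, Complex.norm_exp, Complex.norm_real, Real.norm_of_nonneg hτ.1.le]
  have h2 : (s * τ * Complex.exp ω - (τ ^ p : ℝ) * Complex.exp (p * ω)).re ≤
      s * Real.exp ω.re + Real.exp (p * ω.re) := by
    refine (Complex.re_le_norm _).trans ((norm_sub_le _ _).trans ?_)
    rw [norm_mul, norm_mul, norm_mul, e1, e2, Complex.norm_real, Complex.norm_real,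
      Complex.norm_real, Real.norm_of_nonneg hs, Real.norm_of_nonneg hτ.1.le,
      Real.norm_of_nonneg h0]
    have := mul_le_of_le_one_right hs hτ.2
    have := mul_le_of_le_one_left (Real.exp_pos (p * ω.re)).le h1
    gcongr
  have h3 := mul_le_of_le_one_left (Real.exp_pos (2 * ω.re)).le hτ.2
  gcongr

lemma logPrimitive_eq_integral_indicator (p s L ψ : ℝ) :
    logPrimitive p s (L + ψ * I) = ∫ t in Ioi (0 : ℝ), (Iic (Real.exp L)).indicator
      (fun t : ℝ => (t : ℂ) * Complex.exp (2 * (ψ * I)) * Complex.exp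
        (s * t * Complex.exp (ψ * I) - (t ^ p : ℝ) * Complex.exp (p * (ψ * I)))) t := by
  rw [setIntegral_indicator measurableSet_Iic, Ioi_inter_Iic,
    ← intervalIntegral.integral_of_le (Real.exp_pos L).le]
  have := intervalIntegral.smul_integral_comp_mul_right (a := 0) (b := 1)
    (fun t : ℝ => (t : ℂ) * Complex.exp (2 * (ψ * I)) * Complex.exp
        (s * t * Complex.exp (ψ * I) - (t ^ p : ℝ) * Complex.exp (p * (ψ * I)))) (Real.exp L)
  rw [zero_mul, one_mul] at this
  rw [← this, ← intervalIntegral.integral_smul, logPrimitive]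
  refine intervalIntegral.integral_congr fun τ hτ => ?_
  rw [uIcc_of_le zero_le_one] at hτ
  have e1 : (((τ * Real.exp L) ^ p : ℝ) : ℂ) = (τ ^ p : ℝ) * Complex.exp (p * L) := by
    rw [Real.mul_rpow hτ.1 (Real.exp_pos L).le, ← Real.exp_mul, mul_comm L]
    push_cast
    rfl
  simp only [Complex.real_smul, e1, mul_add, Complex.exp_add, two_mul]
  push_cast
  ring_nf

/-- The logarithm of the modulus of the point of argument `ψ` on the curve where
`s * ζ - ζ ^ p` is real. -/
noncomputable def realPhaseLog (p s ψ : ℝ) : ℝ :=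
  Real.log (s * Real.sin ψ / Real.sin (p * ψ)) / (p - 1)

section Curve

variable {p s ψ : ℝ}

lemma mul_sub_two_pi_mem_Ioo (hp : p ∈ Ioo (2 : ℝ) 3)
    (hψ : ψ ∈ Ioo (2 * Real.pi / p) Real.pi) : p * ψ - 2 * Real.pi ∈ Ioo 0 Real.pi := by
  have h := (div_lt_iff₀ (by linarith [hp.1])).1 hψ.1
  constructor
  · linarith
  · nlinarith [hp.1, hp.2, hψ.2, Real.pi_pos]

lemma sin_mul_pos (hp : p ∈ Ioo (2 : ℝ) 3) (hψ : ψ ∈ Ioo (2 * Real.pi / p) Real.pi) :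
    0 < Real.sin (p * ψ) := by
  rw [← Real.sin_sub_two_pi]
  exact Real.sin_pos_of_mem_Ioo (mul_sub_two_pi_mem_Ioo hp hψ)

lemma two_pi_div_pos (hp : p ∈ Ioo (2 : ℝ) 3) : 0 < 2 * Real.pi / p := by
  have := hp.1
  have := Real.pi_pos
  positivity

lemma sin_pos_of_mem_arc (hp : p ∈ Ioo (2 : ℝ) 3) (hψ : ψ ∈ Ioo (2 * Real.pi / p) Real.pi) :
    0 < Real.sin ψ :=
  Real.sin_pos_of_mem_Ioo ⟨(two_pi_div_pos hp).trans hψ.1, hψ.2⟩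

/-- The point of argument `ψ` on the curve lies on it: the phase vanishes. -/
lemma exp_realPhaseLog_phase (hp : p ∈ Ioo (2 : ℝ) 3) (hs : 0 < s)
    (hψ : ψ ∈ Ioo (2 * Real.pi / p) Real.pi) :
    s * Real.exp (realPhaseLog p s ψ) * Real.sin ψ =
      Real.exp (p * realPhaseLog p s ψ) * Real.sin (p * ψ) := by
  have h1 := sin_mul_pos hp hψ
  have h2 := sin_pos_of_mem_arc hp hψ
  have hp1 : p - 1 ≠ 0 := by linarith [hp.1]
  have e : p * realPhaseLog p s ψ =
      Real.log (s * Real.sin ψ / Real.sin (p * ψ)) + realPhaseLog p s ψ := by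
    rw [realPhaseLog]
    field_simp
    ring
  rw [e, Real.exp_add, Real.exp_log (by positivity)]
  field_simp

lemma hasDerivAt_realPhaseLog (hp : p ∈ Ioo (2 : ℝ) 3) (hs : 0 < s)
    (hψ : ψ ∈ Ioo (2 * Real.pi / p) Real.pi) :
    HasDerivAt (realPhaseLog p s) ((Real.cos ψ / Real.sin ψ -
      p * Real.cos (p * ψ) / Real.sin (p * ψ)) / (p - 1)) ψ := by
  have h1 := sin_mul_pos hp hψ
  have h2 := sin_pos_of_mem_arc hp hψ
  have d1 : HasDerivAt (fun x => Real.sin (p * x)) (Real.cos (p * ψ) * p) ψ := by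
    simpa using ((hasDerivAt_id ψ).const_mul p).sin
  have d2 := ((((Real.hasDerivAt_sin ψ).const_mul s).div d1 h1.ne').log
    (by simp only [Pi.div_apply]; positivity)).div_const (p - 1)
  refine d2.congr_deriv ?_
  congr 1
  simp only [Pi.div_apply]
  field_simp

lemma one_le_curve_slope (hp : p ∈ Ioo (2 : ℝ) 3) (hψ : ψ ∈ Ioo (2 * Real.pi / p) Real.pi) :
    1 ≤ Real.sin (2 * ψ) * (Real.cos ψ / Real.sin ψ - p * Real.cos (p * ψ) / Real.sin (p * ψ)) +
      (p - 1) * Real.cos (2 * ψ) := by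
  have h1 := sin_mul_pos hp hψ
  have h2 := sin_pos_of_mem_arc hp hψ
  have h3 : 0 ≤ Real.sin (p * ψ - 2 * ψ) := by
    refine Real.sin_nonneg_of_nonneg_of_le_pi ?_ ?_
    · nlinarith [hp.1, two_pi_div_pos hp, hψ.1]
    · nlinarith [hp.1, hp.2, two_pi_div_pos hp, hψ.1, hψ.2]
  rw [Real.sin_sub] at h3
  have h4 : Real.sin (2 * ψ) * (Real.cos ψ / Real.sin ψ) = 1 + Real.cos (2 * ψ) := by
    rw [Real.sin_two_mul, Real.cos_two_mul]
    field_simp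
    ring
  have h5 : Real.sin (2 * ψ) * (p * Real.cos (p * ψ) / Real.sin (p * ψ)) ≤
      p * Real.cos (2 * ψ) := by
    rw [← mul_div_assoc, div_le_iff₀ h1]
    nlinarith [hp.1]
  rw [mul_sub, h4]
  linarith

lemma monotoneOn_im_logPrimitive (hp : p ∈ Ioo (2 : ℝ) 3) (hs : 0 < s) :
    MonotoneOn (fun ψ : ℝ => (logPrimitive p s (realPhaseLog p s ψ + ψ * I)).im)
      (Ioo (2 * Real.pi / p) Real.pi) := by
  have key : ∀ ψ ∈ Ioo (2 * Real.pi / p) Real.pi, ∃ d : ℝ, 0 ≤ d ∧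
      HasDerivAt (fun ψ : ℝ => (logPrimitive p s (realPhaseLog p s ψ + ψ * I)).im) d ψ := by
    intro ψ hψ
    set L := realPhaseLog p s ψ with hL
    set L' := (Real.cos ψ / Real.sin ψ -
      p * Real.cos (p * ψ) / Real.sin (p * ψ)) / (p - 1) with hL'
    have h1 : HasDerivAt (fun ψ : ℝ => (realPhaseLog p s ψ + ψ * I : ℂ)) (L' + I) ψ := by
      have := (hasDerivAt_realPhaseLog hp hs hψ).ofReal_comp.add
        ((Complex.ofRealCLM.hasDerivAt (x := ψ)).mul_const I)
      exact this.congr_deriv (by simp [hL'])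
    have h2 := (hasDerivAt_logPrimitive (p := p) (by linarith [hp.1]) s
      (L + ψ * I : ℂ)).comp ψ h1
    have h3 := Complex.imCLM.hasFDerivAt.comp_hasDerivAt ψ h2
    refine ⟨_, ?_, h3⟩
    have e1 : Complex.exp (L + ψ * I : ℂ) =
        Real.exp L * (Real.cos ψ + Real.sin ψ * I) := by
      rw [Complex.exp_add, Complex.exp_mul_I]
      push_cast
      rfl
    have e2 : Complex.exp (p * (L + ψ * I) : ℂ) =
        Real.exp (p * L) * (Real.cos (p * ψ) + Real.sin (p * ψ) * I) := by
      rw [mul_add, ← mul_assoc, Complex.exp_add, Complex.exp_mul_I]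
      push_cast
      rfl
    have e3 : Complex.exp (2 * (L + ψ * I) : ℂ) =
        Real.exp (2 * L) * (Real.cos (2 * ψ) + Real.sin (2 * ψ) * I) := by
      rw [mul_add, ← mul_assoc, Complex.exp_add, Complex.exp_mul_I]
      push_cast
      rfl
    have hphase := exp_realPhaseLog_phase hp hs hψ
    have e4 : (s * Complex.exp (L + ψ * I) - Complex.exp (p * (L + ψ * I)) : ℂ) =
        ((s * Real.exp L * Real.cos ψ - Real.exp (p * L) * Real.cos (p * ψ) : ℝ) : ℂ) := by
      rw [e1, e2]
      apply Complex.ext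
      · simp [-Complex.ofReal_exp, -Complex.ofReal_cos, -Complex.ofReal_sin]
        ring
      · simp [-Complex.ofReal_exp, -Complex.ofReal_cos, -Complex.ofReal_sin]
        linarith
    rw [e4, e3, ← Complex.ofReal_exp]
    set X := Real.exp (s * Real.exp L * Real.cos ψ - Real.exp (p * L) * Real.cos (p * ψ))
    have e5 : imCLM (Real.exp (2 * L) * (Real.cos (2 * ψ) + Real.sin (2 * ψ) * I) * X *
        (L' + I)) = Real.exp (2 * L) * X * (Real.sin (2 * ψ) * L' + Real.cos (2 * ψ)) := by
      simp [-Complex.ofReal_exp, -Complex.ofReal_cos, -Complex.ofReal_sin]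
      ring
    rw [e5]
    have hp1 : 0 < p - 1 := by linarith [hp.1]
    have e6 : Real.sin (2 * ψ) * L' + Real.cos (2 * ψ) = (Real.sin (2 * ψ) *
        (Real.cos ψ / Real.sin ψ - p * Real.cos (p * ψ) / Real.sin (p * ψ)) +
        (p - 1) * Real.cos (2 * ψ)) / (p - 1) := by
      rw [hL']
      field_simp
    rw [e6]
    have := one_le_curve_slope hp hψ
    have hX : 0 < X := Real.exp_pos _
    refine mul_nonneg (by positivity) (div_nonneg (by linarith) hp1.le)
  refine monotoneOn_of_deriv_nonneg (convex_Ioo _ _) ?_ ?_ ?_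
  · intro ψ hψ
    obtain ⟨d, -, h⟩ := key ψ hψ
    exact h.continuousAt.continuousWithinAt
  · intro ψ hψ
    rw [interior_Ioo] at hψ
    obtain ⟨d, -, h⟩ := key ψ hψ
    exact h.differentiableAt.differentiableWithinAt
  · intro ψ hψ
    rw [interior_Ioo] at hψ
    obtain ⟨d, hd, h⟩ := key ψ hψ
    rwa [h.deriv]

lemma two_pi_div_lt_pi (hp : p ∈ Ioo (2 : ℝ) 3) : 2 * Real.pi / p < Real.pi := by
  rw [div_lt_iff₀ (by linarith [hp.1])]
  nlinarith [hp.1, Real.pi_pos]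

lemma tendsto_realPhaseLog_pi (hp : p ∈ Ioo (2 : ℝ) 3) (hs : 0 < s) :
    Tendsto (realPhaseLog p s) (nhdsWithin Real.pi (Iio Real.pi)) atBot := by
  have hsin : Real.sin (p * Real.pi) ≠ 0 := by
    rw [← Real.sin_sub_two_pi]
    refine (Real.sin_pos_of_mem_Ioo ⟨?_, ?_⟩).ne' <;> nlinarith [hp.1, hp.2, Real.pi_pos]
  refine Tendsto.atBot_div_const (by linarith [hp.1]) (Real.tendsto_log_nhdsGT_zero.comp ?_)
  refine tendsto_nhdsWithin_iff.2 ⟨?_, ?_⟩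
  · have : ContinuousAt (fun ψ => s * Real.sin ψ / Real.sin (p * ψ)) Real.pi :=
      ContinuousAt.div (by fun_prop) (by fun_prop) hsin
    simpa using this.tendsto.mono_left nhdsWithin_le_nhds
  · filter_upwards [Ioo_mem_nhdsLT (two_pi_div_lt_pi hp)] with ψ hψ
    exact div_pos (mul_pos hs (sin_pos_of_mem_arc hp hψ)) (sin_mul_pos hp hψ)

lemma tendsto_realPhaseLog_two_pi_div (hp : p ∈ Ioo (2 : ℝ) 3) (hs : 0 < s) :
    Tendsto (realPhaseLog p s) (nhdsWithin (2 * Real.pi / p) (Ioi (2 * Real.pi / p))) atTop := by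
  have hp0 : p ≠ 0 := by linarith [hp.1]
  refine Tendsto.atTop_div_const (by linarith [hp.1]) (Real.tendsto_log_atTop.comp ?_)
  have h0 : 0 < s * Real.sin (2 * Real.pi / p) :=
    mul_pos hs (Real.sin_pos_of_mem_Ioo ⟨two_pi_div_pos hp, two_pi_div_lt_pi hp⟩)
  refine Tendsto.pos_mul_atTop h0 (f := fun ψ => s * Real.sin ψ) ?_
    (tendsto_inv_nhdsGT_zero.comp (f := fun ψ => Real.sin (p * ψ)) ?_)
  · exact (by fun_prop : Continuous fun ψ => s * Real.sin ψ).tendsto _ |>.mono_left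
      nhdsWithin_le_nhds
  · refine tendsto_nhdsWithin_iff.2 ⟨?_, ?_⟩
    · have := (by fun_prop : Continuous fun ψ => Real.sin (p * ψ)).tendsto (2 * Real.pi / p)
      rw [mul_div_cancel₀ _ hp0, Real.sin_two_pi] at this
      exact this.mono_left nhdsWithin_le_nhds
    · filter_upwards [Ioo_mem_nhdsGT (two_pi_div_lt_pi hp)] with ψ hψ
      exact sin_mul_pos hp hψ

lemma im_logPrimitive_nonpos (hp : p ∈ Ioo (2 : ℝ) 3) (hs : 0 < s)
    (hψ : ψ ∈ Ioo (2 * Real.pi / p) Real.pi) :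
    (logPrimitive p s (realPhaseLog p s ψ + ψ * I)).im ≤ 0 := by
  have hL := tendsto_realPhaseLog_pi hp hs
  have hp0 : 0 < p := by linarith [hp.1]
  have hE := Real.tendsto_exp_atBot
  have hbound : Tendsto (fun ψ => Real.exp (2 * realPhaseLog p s ψ) * Real.exp
      (s * Real.exp (realPhaseLog p s ψ) + Real.exp (p * realPhaseLog p s ψ)))
      (nhdsWithin Real.pi (Iio Real.pi)) (nhds 0) := by
    have h1 := hE.comp (hL.const_mul_atBot two_pos)
    have h2 := hE.comp (hL.const_mul_atBot hp0)
    have h3 := ((hE.comp hL).const_mul s).add h2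
    simpa using! h1.mul ((Real.continuous_exp.tendsto _).comp h3)
  have hlim : Tendsto (fun ψ : ℝ => (logPrimitive p s (realPhaseLog p s ψ + ψ * I)).im)
      (nhdsWithin Real.pi (Iio Real.pi)) (nhds 0) := by
    refine squeeze_zero_norm (fun ψ => ?_) hbound
    refine (Complex.abs_im_le_norm _).trans ?_
    simpa using norm_logPrimitive_le hp0.le hs.le (realPhaseLog p s ψ + ψ * I : ℂ)
  refine ge_of_tendsto hlim ?_
  filter_upwards [Ioo_mem_nhdsLT hψ.2] with x hx
  exact monotoneOn_im_logPrimitive hp hs hψ ⟨hψ.1.trans hx.1, hx.2⟩ hx.1.le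

end Curve

section Ray

variable {p s : ℝ}

lemma re_phase (s t p ψ : ℝ) :
    (s * t * Complex.exp (ψ * I) - (t ^ p : ℝ) * Complex.exp (p * (ψ * I))).re =
      s * t * Real.cos ψ - t ^ p * Real.cos (p * ψ) := by
  rw [← mul_assoc, ← Complex.ofReal_mul, ← Complex.ofReal_mul, Complex.sub_re,
    Complex.re_ofReal_mul, Complex.re_ofReal_mul, Complex.exp_ofReal_mul_I_re,
    Complex.exp_ofReal_mul_I_re]

lemma im_phase (s t p ψ : ℝ) :
    (s * t * Complex.exp (ψ * I) - (t ^ p : ℝ) * Complex.exp (p * (ψ * I))).im =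
      s * t * Real.sin ψ - t ^ p * Real.sin (p * ψ) := by
  rw [← mul_assoc, ← Complex.ofReal_mul, ← Complex.ofReal_mul, Complex.sub_im,
    Complex.im_ofReal_mul, Complex.im_ofReal_mul, Complex.exp_ofReal_mul_I_im,
    Complex.exp_ofReal_mul_I_im]

lemma tendsto_logPrimitive_two_pi_div (hp : p ∈ Ioo (2 : ℝ) 3) (hs : 0 < s) :
    Tendsto (fun ψ : ℝ => logPrimitive p s (realPhaseLog p s ψ + ψ * I))
      (nhdsWithin (2 * Real.pi / p) (Ioi (2 * Real.pi / p)))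
      (nhds (∫ t in Ioi (0 : ℝ), (t : ℂ) * Complex.exp (2 * ((2 * Real.pi / p : ℝ) * I)) *
        Complex.exp (s * t * Complex.exp ((2 * Real.pi / p : ℝ) * I) -
          (t ^ p : ℝ) * Complex.exp (p * ((2 * Real.pi / p : ℝ) * I))))) := by
  have hp0 : p ≠ 0 := by linarith [hp.1]
  simp only [logPrimitive_eq_integral_indicator]
  refine tendsto_integral_filter_of_dominated_convergence
    (fun t => t ^ (1 : ℝ) * Real.exp (s * t - 1 / 2 * t ^ p)) ?_ ?_ ?_ ?_
  · exact Eventually.of_forall fun ψ => Measurable.aestronglyMeasurable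
      (Measurable.indicator (by fun_prop) measurableSet_Iic)
  · have hcos : ∀ᶠ ψ in nhdsWithin (2 * Real.pi / p) (Ioi (2 * Real.pi / p)),
        1 / 2 < Real.cos (p * ψ) := by
      have := (by fun_prop : Continuous fun ψ => Real.cos (p * ψ)).tendsto (2 * Real.pi / p)
      rw [mul_div_cancel₀ _ hp0, Real.cos_two_pi] at this
      exact (this.mono_left nhdsWithin_le_nhds).eventually_const_lt (by norm_num)
    filter_upwards [hcos] with ψ hψ
    refine (ae_restrict_iff' measurableSet_Ioi).2 (ae_of_all _ fun t ht => ?_)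
    have ht : 0 < t := ht
    refine (norm_indicator_le_norm_self _ _).trans ?_
    have e : ‖Complex.exp (2 * (ψ * I))‖ = 1 := by
      simpa [mul_assoc] using Complex.norm_exp_ofReal_mul_I (2 * ψ)
    rw [norm_mul, norm_mul, e, Complex.norm_real, Real.norm_of_nonneg ht.le, mul_one,
      Real.rpow_one, Complex.norm_exp, re_phase]
    have htp : 0 ≤ t ^ p := Real.rpow_nonneg ht.le p
    gcongr ?_ * Real.exp (?_ - ?_)
    · exact mul_le_of_le_one_right (by positivity) (Real.cos_le_one ψ)
    · nlinarith
  · exact integrableOn_rpow_mul_exp_sub_rpow hp.1.le (by norm_num) (by norm_num) s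
  · refine ae_of_all _ fun t => ?_
    have hev : ∀ᶠ ψ in nhdsWithin (2 * Real.pi / p) (Ioi (2 * Real.pi / p)),
        t ≤ Real.exp (realPhaseLog p s ψ) :=
      (Real.tendsto_exp_atTop.comp (tendsto_realPhaseLog_two_pi_div hp hs)).eventually_ge_atTop t
    have hc : Continuous fun ψ : ℝ => (t : ℂ) * Complex.exp (2 * (ψ * I)) * Complex.exp
        (s * t * Complex.exp (ψ * I) - (t ^ p : ℝ) * Complex.exp (p * (ψ * I))) := by
      fun_prop
    refine ((hc.tendsto _).mono_left nhdsWithin_le_nhds).congr' ?_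
    filter_upwards [hev] with ψ hψ
    rw [indicator_of_mem (mem_Iic.2 hψ)]

lemma integral_sin_ray_nonpos_of_mem_Ioo (hp : p ∈ Ioo (2 : ℝ) 3) (hs : 0 < s) :
    ∫ u in Ioi (0 : ℝ), u * Real.exp (s * u * Real.cos (2 * Real.pi / p) - u ^ p) *
      Real.sin (s * u * Real.sin (2 * Real.pi / p) + 2 * (2 * Real.pi / p)) ≤ 0 := by
  have hp0 : p ≠ 0 := by linarith [hp.1]
  have hlim := (Complex.continuous_im.tendsto _).comp (tendsto_logPrimitive_two_pi_div hp hs)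
  have hle := le_of_tendsto hlim (b := 0) (by
    filter_upwards [Ioo_mem_nhdsGT (two_pi_div_lt_pi hp)] with ψ hψ
    exact im_logPrimitive_nonpos hp hs hψ)
  set β := 2 * Real.pi / p with hβ
  have hpβ : p * β = 2 * Real.pi := mul_div_cancel₀ _ hp0
  have hint : IntegrableOn (fun t : ℝ => (t : ℂ) * Complex.exp (2 * (β * I)) *
      Complex.exp (s * t * Complex.exp (β * I) - (t ^ p : ℝ) * Complex.exp (p * (β * I))))
      (Ioi 0) := by
    refine Integrable.mono' (integrableOn_rpow_mul_exp_sub_rpow hp.1.le one_pos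
      (by norm_num : (-1 : ℝ) < 1) s) (Measurable.aestronglyMeasurable (by fun_prop)) ?_
    refine (ae_restrict_iff' measurableSet_Ioi).2 (ae_of_all _ fun t ht => ?_)
    have ht : 0 < t := ht
    have e : ‖Complex.exp (2 * (β * I))‖ = 1 := by
      simpa [mul_assoc] using Complex.norm_exp_ofReal_mul_I (2 * β)
    rw [norm_mul, norm_mul, e, Complex.norm_real, Real.norm_of_nonneg ht.le, mul_one,
      Real.rpow_one, Complex.norm_exp, re_phase, hpβ, Real.cos_two_pi, one_mul, mul_one]
    gcongr ?_ * Real.exp (?_ - ?_)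
    exact mul_le_of_le_one_right (by positivity) (Real.cos_le_one β)
  have him := integral_im hint
  simp only [RCLike.im_eq_complex_im] at him
  rw [← him] at hle
  refine le_of_eq_of_le (setIntegral_congr_fun measurableSet_Ioi fun u _ => ?_) hle
  rw [mul_assoc (u : ℂ), ← Complex.exp_add, Complex.im_ofReal_mul, Complex.exp_im, Complex.add_re,
    Complex.add_im, re_phase, im_phase, hpβ, Real.cos_two_pi, Real.sin_two_pi]
  simp
  ring_nf

lemma integral_sin_ray_nonpos (hp : p ∈ Icc (2 : ℝ) 3) (hs : 0 < s) :
    ∫ u in Ioi (0 : ℝ), u * Real.exp (s * u * Real.cos (2 * Real.pi / p) - u ^ p) *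
      Real.sin (s * u * Real.sin (2 * Real.pi / p) + 2 * (2 * Real.pi / p)) ≤ 0 := by
  let J : ℝ → ℝ := fun p => ∫ u in Ioi (0 : ℝ),
    u * Real.exp (s * u * Real.cos (2 * Real.pi / p) - u ^ p) *
      Real.sin (s * u * Real.sin (2 * Real.pi / p) + 2 * (2 * Real.pi / p))
  have hJ : ContinuousOn J (Icc 2 3) := by
    refine continuousOn_of_dominated (bound := fun u => Real.exp 1 *
      (u ^ (1 : ℝ) * Real.exp (s * u - 1 * u ^ (2 : ℝ)))) ?_ ?_ ?_ ?_
    · exact fun q _ => Measurable.aestronglyMeasurable (by fun_prop)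
    · intro q hq
      refine (ae_restrict_iff' measurableSet_Ioi).2 (ae_of_all _ fun u hu => ?_)
      have hu : 0 < u := hu
      have h1 : u ^ (2 : ℝ) - 1 ≤ u ^ q := by
        rcases le_total 1 u with h | h
        · linarith [Real.rpow_le_rpow_of_exponent_le h hq.1]
        · linarith [Real.rpow_nonneg hu.le q, Real.rpow_le_one hu.le h zero_le_two]
      have h2 := mul_le_of_le_one_right (mul_nonneg hs.le hu.le)
        (Real.cos_le_one (2 * Real.pi / q))
      rw [norm_mul, Real.norm_of_nonneg (by positivity), Real.rpow_one, mul_left_comm,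
        ← Real.exp_add]
      refine (mul_le_of_le_one_right (by positivity) (Real.abs_sin_le_one _)).trans ?_
      gcongr
      linarith
    · exact (integrableOn_rpow_mul_exp_sub_rpow le_rfl one_pos (by norm_num) s).const_mul _
    · refine (ae_restrict_iff' measurableSet_Ioi).2 (ae_of_all _ fun u hu => ?_)
      have hu : 0 < u := hu
      have hd : ContinuousOn (fun q : ℝ => 2 * Real.pi / q) (Icc 2 3) :=
        continuousOn_const.div continuousOn_id fun q hq => by
          have := hq.1
          exact (by linarith : q ≠ 0)
      have hr : Continuous (fun q : ℝ => u ^ q) := Real.continuous_const_rpow hu.ne'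
      fun_prop
  have hcl : Icc (2 : ℝ) 3 = closure (Ioo 2 3) := (closure_Ioo (by norm_num)).symm
  refine ContinuousWithinAt.closure_le (f := J) (g := fun _ => 0) (s := Ioo 2 3) (hcl ▸ hp)
    ((hJ p hp).mono Ioo_subset_Icc_self) continuousWithinAt_const fun q hq => ?_
  exact integral_sin_ray_nonpos_of_mem_Ioo hq hs

end Ray

section RayDiff

variable {p : ℝ}

lemma monotoneOn_re_rayDiff (hp : 2 ≤ p) {c : ℂ} (hc : ‖c‖ ≤ 1) :
    MonotoneOn (fun s => (rayDiff p c s).re) (Ici 0) := by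
  have hd (s : ℝ) := Complex.reCLM.hasFDerivAt.comp_hasDerivAt s (hasDerivAt_rayDiff hp hc s).2
  refine monotoneOn_of_deriv_nonneg (convex_Ici 0)
    (fun s _ => (hd s).continuousAt.continuousWithinAt)
    (fun s _ => (hd s).differentiableAt.differentiableWithinAt) fun s hs => ?_
  rw [interior_Ici] at hs
  have hs : 0 < s := hs
  refine (hd s).deriv.symm ▸ ?_
  have hre := integral_re (hasDerivAt_rayDiff hp hc s).1
  simp only [RCLike.re_eq_complex_re] at hre
  rw [Complex.reCLM_apply, ← hre]
  refine setIntegral_nonneg measurableSet_Ioi fun u hu => ?_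
  have hu : 0 < u := hu
  rw [mul_assoc, Complex.re_ofReal_mul, Complex.re_mul_ofReal, Complex.sub_re]
  have h1 : (Complex.exp (s * u)).re = Real.exp (s * u) := by
    rw [← Complex.ofReal_mul, Complex.exp_ofReal_re]
  have h2 : (c ^ 2 * Complex.exp (c * s * u)).re ≤ Real.exp (s * u) := by
    refine (Complex.re_le_norm _).trans ?_
    rw [norm_mul, norm_pow]
    have := norm_exp_mul_mul_le hc (x := s) hu.le
    rw [abs_of_pos hs] at this
    exact (mul_le_of_le_one_left (norm_nonneg _) (pow_le_one₀ (norm_nonneg c) hc)).trans this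
  exact mul_nonneg hu.le (mul_nonneg (by linarith) (Real.exp_pos _).le)

lemma antitoneOn_im_rayDiff (hp : p ∈ Icc (2 : ℝ) 3) :
    AntitoneOn (fun s => (rayDiff p (Complex.exp ((-(2 * Real.pi / p) : ℝ) * I)) s).im)
      (Ioi 0) := by
  set β := 2 * Real.pi / p with hβ
  have hc : ‖Complex.exp ((-β : ℝ) * I)‖ ≤ 1 := (Complex.norm_exp_ofReal_mul_I _).le
  have hd (s : ℝ) := Complex.imCLM.hasFDerivAt.comp_hasDerivAt s (hasDerivAt_rayDiff hp.1 hc s).2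
  refine antitoneOn_of_deriv_nonpos (convex_Ioi 0)
    (fun s _ => (hd s).continuousAt.continuousWithinAt)
    (fun s _ => (hd s).differentiableAt.differentiableWithinAt) fun s hs => ?_
  rw [interior_Ioi] at hs
  refine (hd s).deriv.symm ▸ ?_
  have him := integral_im (hasDerivAt_rayDiff hp.1 hc s).1
  simp only [RCLike.im_eq_complex_im] at him
  rw [Complex.imCLM_apply, ← him]
  refine le_of_eq_of_le (setIntegral_congr_fun measurableSet_Ioi fun u _ => ?_)
    (integral_sin_ray_nonpos hp hs)
  have h1 : (Complex.exp (s * u)).im = 0 := by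
    rw [← Complex.ofReal_mul, Complex.exp_ofReal_im]
  have h2 : (Complex.exp ((-β : ℝ) * I) ^ 2 * Complex.exp (Complex.exp ((-β : ℝ) * I) * s * u)).im =
      -(Real.exp (s * u * Real.cos β) * Real.sin (s * u * Real.sin β + 2 * β)) := by
    have e : Complex.exp ((-β : ℝ) * I) * s * u = (s * u : ℝ) * Complex.exp ((-β : ℝ) * I) := by
      push_cast
      ring
    rw [← Complex.exp_nat_mul, ← Complex.exp_add, Complex.exp_im, Complex.add_re, Complex.add_im,
      e, Complex.re_ofReal_mul, Complex.im_ofReal_mul, Complex.exp_ofReal_mul_I_re,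
      Complex.exp_ofReal_mul_I_im, Real.cos_neg, Real.sin_neg]
    simp
    have hsin : Real.sin (-(2 * β) + -(s * u * Real.sin β)) =
        -Real.sin (s * u * Real.sin β + 2 * β) := by
      rw [← Real.sin_neg]
      ring_nf
    rw [hsin, mul_neg]
  rw [mul_assoc (u : ℂ), Complex.im_ofReal_mul, Complex.im_mul_ofReal, Complex.sub_im, h1, h2,
    sub_eq_add_neg (s * u * Real.cos β), Real.exp_add]
  ring

lemma rayDiff_zero (p : ℝ) (c : ℂ) :
    rayDiff p c 0 = (1 - c) * ((∫ u in Ioi (0 : ℝ), Real.exp (-u ^ p) : ℝ) : ℂ) := by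
  rw [rayDiff, ← integral_complex_ofReal, ← integral_const_mul]
  simp

lemma integral_exp_neg_rpow_pos (hp : 2 ≤ p) : 0 < ∫ u in Ioi (0 : ℝ), Real.exp (-u ^ p) := by
  rw [_root_.integral_exp_neg_rpow (by linarith)]
  exact Real.Gamma_pos_of_pos (by positivity)

lemma tendsto_im_rayDiff_atTop (hp : 2 ≤ p) {c : ℂ} (hc : ‖c‖ ≤ 1) (hre : c.re < 0) :
    Tendsto (fun s => (rayDiff p c s).im) atTop (nhds 0) := by
  have him : ∀ s : ℝ, 0 ≤ s → (rayDiff p c s).im = ∫ u in Ioi (0 : ℝ),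
      -((c * Complex.exp (c * s * u)).im * Real.exp (-u ^ p)) := by
    intro s hs
    have hint : IntegrableOn (fun u : ℝ => (Complex.exp (s * u) - c * Complex.exp (c * s * u)) *
        (Real.exp (-u ^ p) : ℂ)) (Ioi 0) := by
      refine Integrable.mono' ((integrableOn_rpow_mul_exp_sub_rpow hp one_pos
        (by norm_num : (-1 : ℝ) < 0) s).const_mul 2)
        (Measurable.aestronglyMeasurable (by fun_prop)) ?_
      refine (ae_restrict_iff' measurableSet_Ioi).2 (ae_of_all _ fun u hu => ?_)
      simpa using norm_exp_sub_mul_exp_le hc hc p (abs_of_nonneg hs).le hu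
    have h := integral_im hint
    simp only [RCLike.im_eq_complex_im] at h
    rw [rayDiff, ← h]
    refine integral_congr_ae (ae_of_all _ fun u => ?_)
    simp only
    rw [Complex.im_mul_ofReal, Complex.sub_im, ← Complex.ofReal_mul, Complex.exp_ofReal_im]
    ring
  have hlim : Tendsto (fun s : ℝ => ∫ u in Ioi (0 : ℝ),
      -((c * Complex.exp (c * s * u)).im * Real.exp (-u ^ p))) atTop
      (nhds (∫ _ in Ioi (0 : ℝ), (0 : ℝ))) := by
    have hnorm : ∀ s u : ℝ, ‖-((c * Complex.exp (c * s * u)).im * Real.exp (-u ^ p))‖ ≤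
        Real.exp (c.re * u * s) * Real.exp (-u ^ p) := by
      intro s u
      rw [norm_neg, norm_mul, Real.norm_of_nonneg (Real.exp_pos _).le]
      gcongr
      refine (Complex.abs_im_le_norm _).trans ?_
      rw [norm_mul, Complex.norm_exp]
      refine (mul_le_of_le_one_left (Real.exp_pos _).le hc).trans (le_of_eq ?_)
      simp
      ring
    refine tendsto_integral_filter_of_dominated_convergence
      (fun u => u ^ (0 : ℝ) * Real.exp (0 * u - 1 * u ^ p)) ?_ ?_ ?_ ?_
    · refine Eventually.of_forall fun s => Measurable.aestronglyMeasurable ?_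
      exact ((Complex.measurable_im.comp (by fun_prop)).mul (by fun_prop)).neg
    · filter_upwards [eventually_ge_atTop 0] with s hs
      refine (ae_restrict_iff' measurableSet_Ioi).2 (ae_of_all _ fun u hu => ?_)
      have hu : 0 < u := hu
      refine (hnorm s u).trans ?_
      rw [Real.rpow_zero, one_mul, zero_mul, zero_sub, one_mul]
      refine mul_le_of_le_one_left (Real.exp_pos _).le (Real.exp_le_one_iff.2 ?_)
      nlinarith [mul_pos_of_neg_of_neg hre (neg_neg_of_pos hu), mul_nonneg hu.le hs]
    · exact integrableOn_rpow_mul_exp_sub_rpow hp one_pos (by norm_num) 0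
    · refine (ae_restrict_iff' measurableSet_Ioi).2 (ae_of_all _ fun u hu => ?_)
      refine squeeze_zero_norm (fun s => hnorm s u) ?_
      have h1 : Tendsto (fun s : ℝ => c.re * u * s) atTop atBot :=
        tendsto_id.const_mul_atTop_of_neg (mul_neg_of_neg_of_pos hre hu)
      simpa using (Real.tendsto_exp_atBot.comp h1).mul_const (Real.exp (-u ^ p))
  rw [integral_zero] at hlim
  refine hlim.congr' ?_
  filter_upwards [eventually_ge_atTop 0] with s hs
  exact (him s hs).symm

end RayDiff

lemma arg_mk_neg_of_pos {a : ℝ} (b : ℝ) (ha : 0 < a) :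
    (⟨b, -a⟩ : ℂ).arg = Real.arctan (b / a) - Real.pi / 2 := by
  set t := Real.arctan (b / a) with ht
  have hcos : 0 < Real.cos t := Real.cos_arctan_pos _
  have htan : b / a = Real.sin t / Real.cos t := by
    rw [← Real.tan_eq_sin_div_cos, ht, Real.tan_arctan]
  have hb : b = a / Real.cos t * Real.sin t := by
    field_simp at htan ⊢
    linarith
  have e : (⟨b, -a⟩ : ℂ) = (a / Real.cos t : ℝ) *
      (Complex.cos (t - Real.pi / 2 : ℝ) + Complex.sin (t - Real.pi / 2 : ℝ) * I) := by
    rw [← Complex.ofReal_cos, ← Complex.ofReal_sin, Real.cos_sub_pi_div_two,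
      Real.sin_sub_pi_div_two]
    apply Complex.ext
    · simpa [-Complex.ofReal_cos, -Complex.ofReal_sin, -Complex.ofReal_div] using hb
    · simp [-Complex.ofReal_cos, -Complex.ofReal_sin, -Complex.ofReal_div]
      field_simp
  rw [e, Complex.arg_mul_cos_add_sin_mul_I (by positivity)]
  have h1 := Real.neg_pi_div_two_lt_arctan (b / a)
  have h2 := Real.arctan_lt_pi_div_two (b / a)
  constructor <;> linarith [Real.pi_pos]

lemma GalphaPlus_eq {α r : ℝ} (hα : α ∈ Ioc (0 : ℝ) (1 / 2)) (hr : 0 < r) :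
    GalphaPlus α r = (r ^ (1 - α) / (2 * Real.pi * r) : ℝ) *
      ⟨(rayDiff α⁻¹ (Complex.exp ((-(2 * Real.pi * α) : ℝ) * I)) (r ^ (1 - α))).im,
        -(rayDiff α⁻¹ (Complex.exp ((-(2 * Real.pi * α) : ℝ) * I)) (r ^ (1 - α))).re⟩ := by
  have hp : 2 ≤ α⁻¹ := by
    rw [le_inv_comm₀ two_pos hα.1]
    linarith [hα.2]
  set c := Complex.exp ((-(2 * Real.pi * α) : ℝ) * I) with hc
  have hc1 : ‖c‖ ≤ 1 := (Complex.norm_exp_ofReal_mul_I _).le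
  have hs : 0 ≤ r ^ (1 - α) := Real.rpow_nonneg hr.le _
  have key := integral_exp_rpow_eq_rayDiff hp hc1 hs
  have hrs : (r : ℂ) ^ (1 - (α : ℂ)) = (r ^ (1 - α) : ℝ) := by
    rw [Complex.ofReal_cpow hr.le]
    simp
  have hcc : Complex.exp (-(2 * Real.pi * α : ℂ) * Complex.I) = c := by
    rw [hc]
    push_cast
    rfl
  have hint : ∫ y in Set.Ioi (0:ℝ),
      ((Complex.exp ((r:ℂ) ^ (1 - (α:ℂ)) * (y:ℂ) ^ (α:ℂ)) -
        Complex.exp (Complex.exp (-(2 * Real.pi * α : ℂ) * Complex.I) * (r:ℂ) ^ (1 - (α:ℂ)) *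
          (y:ℂ) ^ (α:ℂ))) / (r:ℂ)) * Complex.exp (-(y:ℂ)) =
      (r : ℂ)⁻¹ * ((r ^ (1 - α) : ℝ) * rayDiff α⁻¹ c (r ^ (1 - α))) := by
    rw [← key, ← integral_const_mul]
    refine setIntegral_congr_fun measurableSet_Ioi fun y hy => ?_
    have hy : 0 < y := hy
    rw [hrs, hcc, inv_inv, Complex.ofReal_cpow hy.le, div_eq_inv_mul, mul_assoc,
      Complex.ofReal_exp, Complex.ofReal_neg]
  rw [GalphaPlus, hint]
  set z := rayDiff α⁻¹ c (r ^ (1 - α))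
  have hz : (⟨z.im, -z.re⟩ : ℂ) = -I * z := by
    apply Complex.ext <;> simp
  have hr' : (r : ℂ) ≠ 0 := Complex.ofReal_ne_zero.2 hr.ne'
  have hpi : (Real.pi : ℂ) ≠ 0 := Complex.ofReal_ne_zero.2 Real.pi_ne_zero
  rw [hz, mul_inv, Complex.inv_I, Complex.ofReal_div]
  push_cast
  field_simp

/-- For `α ∈ [1/3, 1/2]`, the function `θ_α` is monotone increasing
on `(0,∞)`, tends to `α` at `0⁺` and to `1/2` at `+∞`. -/
theorem thetaFun_monotone (α : ℝ) (hα : α ∈ Set.Icc (1/3 : ℝ) (1/2)) :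
    MonotoneOn (thetaFun α) (Set.Ioi 0) ∧
    Filter.Tendsto (thetaFun α) (nhdsWithin 0 (Set.Ioi 0)) (nhds α) ∧
    Filter.Tendsto (thetaFun α) Filter.atTop (nhds (1/2)) := by
  have hα0 : 0 < α := by linarith [hα.1]
  have hα1 : 0 < 1 - α := by linarith [hα.2]
  have hpi := Real.pi_pos
  have hp : α⁻¹ ∈ Icc (2 : ℝ) 3 := by
    constructor
    · rw [le_inv_comm₀ two_pos hα0]
      linarith [hα.2]
    · rw [inv_le_comm₀ hα0 three_pos]
      linarith [hα.1]
  have hβ : 2 * Real.pi / α⁻¹ = 2 * Real.pi * α := by rw [div_inv_eq_mul]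
  set c := Complex.exp ((-(2 * Real.pi * α) : ℝ) * I) with hc
  have hc1 : ‖c‖ ≤ 1 := (Complex.norm_exp_ofReal_mul_I _).le
  have hcre : c.re = Real.cos (2 * Real.pi * α) := by
    rw [hc, Complex.exp_ofReal_mul_I_re, Real.cos_neg]
  have hcim : c.im = -Real.sin (2 * Real.pi * α) := by
    rw [hc, Complex.exp_ofReal_mul_I_im, Real.sin_neg]
  have hcre0 : c.re < 0 := by
    rw [hcre]
    apply Real.cos_neg_of_pi_div_two_lt_of_lt <;> nlinarith [hα.1, hα.2]
  have hm := monotoneOn_re_rayDiff hp.1 hc1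
  have hb := antitoneOn_im_rayDiff hp
  rw [hβ, ← hc] at hb
  have hbtop := tendsto_im_rayDiff_atTop hp.1 hc1 hcre0
  have hK := integral_exp_neg_rpow_pos hp.1
  set K := ∫ u in Ioi (0 : ℝ), Real.exp (-u ^ α⁻¹)
  have h0re : (rayDiff α⁻¹ c 0).re = (1 - c.re) * K := by
    rw [rayDiff_zero, Complex.re_mul_ofReal, Complex.sub_re, Complex.one_re]
  have h0im : (rayDiff α⁻¹ c 0).im = -c.im * K := by
    rw [rayDiff_zero, Complex.im_mul_ofReal, Complex.sub_im, Complex.one_im, zero_sub]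
  have hre0 : 0 < (rayDiff α⁻¹ c 0).re := by
    rw [h0re]
    exact mul_pos (by linarith) hK
  have hre : ∀ s : ℝ, 0 ≤ s → (rayDiff α⁻¹ c 0).re ≤ (rayDiff α⁻¹ c s).re :=
    fun s hs => hm self_mem_Ici hs hs
  have him : ∀ s : ℝ, 0 < s → 0 ≤ (rayDiff α⁻¹ c s).im := by
    intro s hs
    refine le_of_tendsto hbtop ?_
    filter_upwards [eventually_ge_atTop s] with x hx
    exact hb hs (hs.trans_le hx) hx
  have hθ : ∀ r ∈ Ioi (0 : ℝ), thetaFun α r = 1 / 2 - Real.arctan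
      ((rayDiff α⁻¹ c (r ^ (1 - α))).im / (rayDiff α⁻¹ c (r ^ (1 - α))).re) / Real.pi := by
    intro r hr
    have hr : 0 < r := hr
    have hs : 0 < r ^ (1 - α) := Real.rpow_pos_of_pos hr _
    rw [thetaFun, GalphaPlus_eq ⟨hα0, hα.2⟩ hr, ← hc, Complex.arg_real_mul _ (by positivity),
      arg_mk_neg_of_pos _ (hre0.trans_le (hre _ hs.le))]
    field_simp
    ring
  refine ⟨?_, ?_, ?_⟩
  · intro r hr q hq hrq
    have hr' : 0 < r := hr
    have hq' : 0 < q := hq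
    have hs : 0 < r ^ (1 - α) := Real.rpow_pos_of_pos hr' _
    have ht : 0 < q ^ (1 - α) := Real.rpow_pos_of_pos hq' _
    have hst : r ^ (1 - α) ≤ q ^ (1 - α) := Real.rpow_le_rpow hr'.le hrq hα1.le
    rw [hθ r hr, hθ q hq]
    have hquot := div_le_div₀ (him _ hs) (hb hs ht hst) (hre0.trans_le (hre _ hs.le))
      (hm hs.le ht.le hst)
    have harctan := Real.arctan_strictMono.monotone hquot
    linarith [div_le_div_of_nonneg_right harctan hpi.le]
  · have hcont : ContinuousAt (rayDiff α⁻¹ c) 0 := (hasDerivAt_rayDiff hp.1 hc1 0).2.continuousAt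
    have hs : Tendsto (fun r : ℝ => r ^ (1 - α)) (nhdsWithin 0 (Ioi 0)) (nhds 0) := by
      have := (Real.continuous_rpow_const hα1.le).tendsto 0
      rw [Real.zero_rpow hα1.ne'] at this
      exact this.mono_left nhdsWithin_le_nhds
    have hz := hcont.tendsto.comp hs
    have hlim := (((Real.continuous_arctan.tendsto _).comp
      (((Complex.continuous_im.tendsto _).comp hz).div
        ((Complex.continuous_re.tendsto _).comp hz) hre0.ne')).div_const Real.pi).const_sub (1 / 2)
    have hval : (rayDiff α⁻¹ c 0).im / (rayDiff α⁻¹ c 0).re =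
        Real.tan (Real.pi / 2 - Real.pi * α) := by
      have hsin : 0 < Real.sin (Real.pi * α) :=
        Real.sin_pos_of_pos_of_lt_pi (by positivity) (by nlinarith [hα.2])
      rw [h0re, h0im, hcre, hcim, neg_neg, mul_div_mul_right _ _ hK.ne', Real.tan_eq_sin_div_cos,
        Real.sin_pi_div_two_sub, Real.cos_pi_div_two_sub, mul_assoc, Real.sin_two_mul,
        Real.cos_two_mul, Real.cos_sq', div_eq_div_iff (by nlinarith) hsin.ne']
      ring
    rw [hval, Real.arctan_tan (by nlinarith [hα.2]) (by nlinarith)] at hlim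
    have e : 1 / 2 - (Real.pi / 2 - Real.pi * α) / Real.pi = α := by
      field_simp
      ring
    rw [e] at hlim
    refine hlim.congr' ?_
    filter_upwards [self_mem_nhdsWithin] with r hr
    exact (hθ r hr).symm
  · have hquot : Tendsto (fun s => (rayDiff α⁻¹ c s).im / (rayDiff α⁻¹ c s).re) atTop
        (nhds 0) := by
      have hbd := hbtop.div_const (rayDiff α⁻¹ c 0).re
      rw [zero_div] at hbd
      refine squeeze_zero' ?_ ?_ hbd
      · filter_upwards [eventually_gt_atTop 0] with s hs
        exact div_nonneg (him s hs) (hre0.le.trans (hre s hs.le))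
      · filter_upwards [eventually_gt_atTop 0] with s hs
        exact div_le_div_of_nonneg_left (him s hs) hre0 (hre s hs.le)
    have hlim := (((Real.continuous_arctan.tendsto _).comp
      (hquot.comp (tendsto_rpow_atTop hα1))).div_const Real.pi).const_sub (1 / 2)
    rw [Real.arctan_zero, zero_div, sub_zero] at hlim
    refine hlim.congr' ?_
    filter_upwards [eventually_gt_atTop 0] with r hr
    exact (hθ r hr).symm
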